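/- arXiv:1310.2860 — 5 statements merged into one kernel-verified Lean document; each statement's English description precedes it below -/
import Mathlib

section
/- Let M, N be positive integers, κ : [1:N] → [1:M] a map, r_1,…,r_N > 0 real numbers, n_1,…,n_N > 0 real numbers with n = ∑_{ℓ=1}^N n_ℓ, P > 0, and P_1,…,P_N ≥ 0 real numbers satisfying the per-node power constraints ∑_{ℓ : κ(ℓ)=i} n_ℓ P_ℓ ≤ nP for every i ∈ [1:M]. Then min_{ℓ∈[1:N]} (n_ℓ/n) · ( (1/2)·log₂(1+P_ℓ) / r_ℓ ) ≤ ( (1/2)·log₂(1+MP) ) / ( ∑_{ℓ=1}^N r_ℓ ). -/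
/-- **Theorem 2 (deterministic core).** Upper bound on the computation rate achievable by
the interactive round-robin approach in the collocated Gaussian network: if each round
`ℓ ∈ [1:N]` uses `n ℓ` channel uses with power `Pl ℓ`, the active sensor in round `ℓ` is
`κ ℓ`, the per-node average power constraints hold, and `r ℓ > 0` are the per-round source
coding rates, then
`min_ℓ (n ℓ / n) * ((1/2) log₂(1 + Pl ℓ) / r ℓ) ≤ ((1/2) log₂(1 + M P)) / ∑ ℓ, r ℓ`. -/
theorem stmt2 (M N : ℕ) (hM : 0 < M) (hN : 0 < N) (κ : Fin N → Fin M)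
    (r : Fin N → ℝ) (hr : ∀ ℓ, 0 < r ℓ)
    (n : Fin N → ℝ) (hn : ∀ ℓ, 0 < n ℓ)
    (P : ℝ) (hP : 0 < P)
    (Pl : Fin N → ℝ) (hPl : ∀ ℓ, 0 ≤ Pl ℓ)
    (hpower : ∀ i : Fin M,
      (∑ ℓ ∈ Finset.univ.filter (fun ℓ => κ ℓ = i), n ℓ * Pl ℓ) ≤ (∑ ℓ, n ℓ) * P) :
    (⨅ ℓ : Fin N, (n ℓ / ∑ ℓ', n ℓ') * ((1 / 2) * Real.logb 2 (1 + Pl ℓ) / r ℓ))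
      ≤ ((1 / 2) * Real.logb 2 (1 + M * P)) / (∑ ℓ, r ℓ) := by
  haveI : Nonempty (Fin N) := ⟨⟨0, hN⟩⟩
  have hS : 0 < ∑ ℓ, n ℓ := Finset.sum_pos (fun i _ => hn i) Finset.univ_nonempty
  have hR : 0 < ∑ ℓ, r ℓ := Finset.sum_pos (fun i _ => hr i) Finset.univ_nonempty
  have htot : ∑ ℓ, n ℓ * Pl ℓ ≤ M * ((∑ ℓ, n ℓ) * P) := by
    rw [← Finset.sum_fiberwise Finset.univ κ (fun ℓ => n ℓ * Pl ℓ)]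
    refine (Finset.sum_le_sum (fun i _ => hpower i)).trans ?_
    simp
  set S := ∑ ℓ, n ℓ with hSdef
  have hw1 : ∑ ℓ, n ℓ / S = 1 := by
    rw [← Finset.sum_div, ← hSdef, div_self hS.ne']
  have hJ : ∑ ℓ, (n ℓ / S) * Real.log (1 + Pl ℓ) ≤ Real.log (∑ ℓ, (n ℓ / S) * (1 + Pl ℓ)) := by
    have := strictConcaveOn_log_Ioi.concaveOn.le_map_sum (t := Finset.univ)
      (w := fun ℓ => n ℓ / S) (p := fun ℓ => 1 + Pl ℓ)
      (fun i _ => (div_pos (hn i) hS).le) hw1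
      (fun i _ => by have := hPl i; simp only [Set.mem_Ioi]; linarith)
    simpa [smul_eq_mul] using this
  have hsum : ∑ ℓ, (n ℓ / S) * (1 + Pl ℓ) = 1 + (∑ ℓ, n ℓ * Pl ℓ) / S := by
    simp only [mul_add, mul_one, Finset.sum_add_distrib, hw1, Finset.sum_div]
    congr 1
    exact Finset.sum_congr rfl (fun i _ => by ring)
  have hnn : 0 ≤ (∑ ℓ, n ℓ * Pl ℓ) / S :=
    div_nonneg (Finset.sum_nonneg (fun i _ => mul_nonneg (hn i).le (hPl i))) hS.le
  have hle : (∑ ℓ, n ℓ * Pl ℓ) / S ≤ M * P := by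
    rw [div_le_iff₀ hS]; linarith
  have hlog : ∑ ℓ, (n ℓ / S) * Real.log (1 + Pl ℓ) ≤ Real.log (1 + M * P) := by
    rw [hsum] at hJ
    exact hJ.trans (Real.log_le_log (by linarith) (by linarith))
  have hl2 : 0 < Real.log 2 := Real.log_pos (by norm_num)
  rw [le_div_iff₀ hR, Finset.mul_sum]
  calc _ ≤ ∑ ℓ, ((n ℓ / S) * ((1 / 2) * Real.logb 2 (1 + Pl ℓ) / r ℓ)) * r ℓ := by
        refine Finset.sum_le_sum (fun i _ => mul_le_mul_of_nonneg_right ?_ (hr i).le)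
        exact ciInf_le (Set.finite_range _).bddBelow i
    _ = (1 / 2) * ((∑ ℓ, (n ℓ / S) * Real.log (1 + Pl ℓ)) / Real.log 2) := by
        rw [Finset.sum_div, Finset.mul_sum]
        refine Finset.sum_congr rfl (fun i _ => ?_)
        have := (hr i).ne'
        simp only [Real.logb]
        field_simp
    _ ≤ _ := by
        simp only [Real.logb]
        gcongr
end

section
/- Let M be a positive integer, P ≥ 0, and β_1,…,β_M ≥ 0 with ∑_{i=1}^M β_i = 1, with the convention that β·(1/2)·log₂(1+P/β) = 0 when β = 0. Then ∑_{i=1}^M β_i·(1/2)·log₂(1+P/β_i) ≤ (1/2)·log₂(1+MP). -/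
/-- **Step (d) in the proof of Theorem 2.** For `β i ≥ 0` summing to `1` and `P ≥ 0`,
`∑ i, β i * (1/2) * log₂(1 + P / β i) ≤ (1/2) * log₂(1 + M P)`.
(When `β i = 0` the corresponding term is `0`, consistent with the convention, since in
Lean `P / 0 = 0` and `0 * _ = 0`.) -/
theorem stmt3 (M : ℕ) (hM : 0 < M) (P : ℝ) (hP : 0 ≤ P)
    (β : Fin M → ℝ) (hβ : ∀ i, 0 ≤ β i) (hsum : (∑ i, β i) = 1) :
    (∑ i, β i * ((1 / 2) * Real.logb 2 (1 + P / β i)))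
      ≤ (1 / 2) * Real.logb 2 (1 + M * P) := by
  have hC : (0:ℝ) < 1 + M * P := by positivity
  have key : ∀ i, β i * Real.log (1 + P / β i) ≤
      β i * (Real.log (1 + M * P) - 1) + (β i + P) / (1 + M * P) := by
    intro i
    have h0 := hβ i
    have hx : (0:ℝ) < 1 + P / β i := by positivity
    have h1 := Real.log_le_sub_one_of_pos (div_pos hx hC)
    rw [Real.log_div hx.ne' hC.ne'] at h1
    have h2 := mul_le_mul_of_nonneg_left h1 h0
    have h3 : β i * (1 + P / β i) ≤ β i + P := by
      rcases h0.eq_or_lt with h | h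
      · rw [← h]; simpa using hP
      · apply le_of_eq
        field_simp
    have h4 : β i * ((1 + P / β i) / (1 + M * P)) ≤ (β i + P) / (1 + M * P) := by
      rw [← mul_div_assoc]
      exact div_le_div_of_nonneg_right h3 hC.le
    linarith
  have hs : ∑ i, β i * Real.log (1 + P / β i) ≤ Real.log (1 + M * P) := by
    refine (Finset.sum_le_sum fun i _ => key i).trans (le_of_eq ?_)
    rw [Finset.sum_add_distrib, ← Finset.sum_mul, ← Finset.sum_div, Finset.sum_add_distrib, hsum]
    simp only [Finset.sum_const, Finset.card_univ, Fintype.card_fin, nsmul_eq_mul]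
    rw [div_self hC.ne']
    ring
  have h2 : 0 < Real.log 2 := Real.log_pos (by norm_num)
  have e : (∑ i, β i * ((1 / 2) * Real.logb 2 (1 + P / β i)))
      = (1 / 2) * ((∑ i, β i * Real.log (1 + P / β i)) / Real.log 2) := by
    rw [Finset.sum_div, Finset.mul_sum]
    refine Finset.sum_congr rfl fun i _ => ?_
    rw [Real.logb]
    ring
  rw [e, Real.logb]
  have := div_le_div_of_nonneg_right hs h2.le
  linarith
end

section
/- Let M be a positive integer, θ a nonnegative integer, ℓ a fixed symbol, and s_1,…,s_M arbitrary symbols. Let A_1,…,A_J be a partition of [1:M] into nonempty pairwise disjoint sets with union [1:M], and define u_0 = 0 and u_m = u_{m−1} + ∑_{i∈A_m} 1{u_{m−1} < θ}·1{s_i = ℓ} for m ∈ [1:J]. Then min{u_J, θ} = min{ b, θ }, where b = ∑_{i=1}^M 1{s_i = ℓ} is the frequency of ℓ in (s_1,…,s_M). In particular, the final description determines the clipped frequency of ℓ. -/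
/-- The (deterministic) descriptions of the clipped frequency of the symbol `ℓ`:
`u₀ = 0` and `u_m = u_{m-1} + ∑_{i ∈ A_m} 1{u_{m-1} < θ} · 1{s i = ℓ}`. -/
def descrVal {α : Type*} [DecidableEq α] {M : ℕ} (s : Fin M → α) (ℓ : α) (θ : ℕ)
    (A : ℕ → Finset (Fin M)) : ℕ → ℕ
  | 0 => 0
  | m + 1 =>
      descrVal s ℓ θ A m +
        if descrVal s ℓ θ A m < θ then ((A (m + 1)).filter fun i => s i = ℓ).card else 0

theorem descrVal_aux {α : Type*} [DecidableEq α] {M : ℕ} (s : Fin M → α) (ℓ : α) (θ : ℕ)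
    (A : ℕ → Finset (Fin M)) (m : ℕ) :
    min (descrVal s ℓ θ A m) θ
      = min (∑ k ∈ Finset.Icc 1 m, ((A k).filter fun i => s i = ℓ).card) θ := by
  induction m with
  | zero => simp [descrVal]
  | succ m ih =>
    rw [Finset.sum_Icc_succ_top (by omega), descrVal]
    split_ifs <;> omega

/-- **Correctness of the descriptions (Section IV).** For any partition `A_1, …, A_J` of
`[1:M]` into nonempty pairwise disjoint groups, the final description determines the
clipped frequency: `min {u_J, θ} = min {b, θ}`, where `b = ∑_{i=1}^M 1{s i = ℓ}` is the
frequency of `ℓ` in `(s₁, …, s_M)`. -/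
theorem stmt7 {α : Type*} [DecidableEq α] (M : ℕ) (hM : 0 < M) (θ : ℕ) (ℓ : α)
    (s : Fin M → α) (J : ℕ) (hJ : 0 < J) (A : ℕ → Finset (Fin M))
    (hne : ∀ m ∈ Finset.Icc 1 J, (A m).Nonempty)
    (hdisj : ∀ m ∈ Finset.Icc 1 J, ∀ m' ∈ Finset.Icc 1 J, m ≠ m' → Disjoint (A m) (A m'))
    (hcover : (Finset.Icc 1 J).biUnion A = Finset.univ) :
    min (descrVal s ℓ θ A J) θ
      = min ((Finset.univ.filter fun i => s i = ℓ).card) θ := by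
  rw [descrVal_aux, ← hcover, Finset.filter_biUnion, Finset.card_biUnion]
  intro m hm m' hm' h
  exact Finset.disjoint_filter_filter (hdisj m hm m' hm' h)
end

section
/- Let M be a positive integer, let p_1,…,p_M ∈ [0,1], and let θ ≥ 1 be a real number with ∑_{i=1}^M p_i ≥ θ. Then there exists a positive integer J and a partition of [1:M] into nonempty pairwise disjoint sets A_1,…,A_J with union [1:M] such that θ ≤ ∑_{i∈A_m} p_i < θ + 1 for every m ∈ [1:J−1], and θ ≤ ∑_{i∈A_J} p_i < 2θ + 1. -/
theorem aux_sub {M : ℕ} (p : Fin M → ℝ) (hp : ∀ i, p i ∈ Set.Icc (0 : ℝ) 1)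
    (θ : ℝ) (hθ : 1 ≤ θ) (S : Finset (Fin M)) : θ ≤ ∑ i ∈ S, p i →
    ∃ T ⊆ S, θ ≤ ∑ i ∈ T, p i ∧ ∑ i ∈ T, p i < θ + 1 := by
  induction S using Finset.induction_on with
  | empty => intro h; simp at h; linarith
  | insert a S ha ih =>
    intro h
    rw [Finset.sum_insert ha] at h
    by_cases hS : θ ≤ ∑ i ∈ S, p i
    · obtain ⟨T, hT, h1⟩ := ih hS
      exact ⟨T, hT.trans (Finset.subset_insert _ _), h1⟩
    · refine ⟨_, Finset.Subset.refl _, ?_⟩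
      rw [Finset.sum_insert ha]
      have := (hp a).2
      exact ⟨h, by linarith⟩

theorem aux_part {M : ℕ} (p : Fin M → ℝ) (hp : ∀ i, p i ∈ Set.Icc (0 : ℝ) 1)
    (θ : ℝ) (hθ : 1 ≤ θ) (S : Finset (Fin M)) : θ ≤ ∑ i ∈ S, p i →
    ∃ (J : ℕ) (A : ℕ → Finset (Fin M)), 0 < J ∧
      (∀ m ∈ Finset.Icc 1 J, ∀ m' ∈ Finset.Icc 1 J, m ≠ m' → Disjoint (A m) (A m')) ∧
      ((Finset.Icc 1 J).biUnion A = S) ∧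
      (∀ m ∈ Finset.Icc 1 (J - 1), θ ≤ (∑ i ∈ A m, p i) ∧ (∑ i ∈ A m, p i) < θ + 1) ∧
      (θ ≤ (∑ i ∈ A J, p i) ∧ (∑ i ∈ A J, p i) < 2 * θ + 1) := by
  induction S using Finset.strongInduction with
  | H S ih =>
    intro h
    by_cases hS : ∑ i ∈ S, p i < 2 * θ + 1
    · refine ⟨1, fun _ => S, one_pos, ?_, by simp, by simp, h, hS⟩
      intro m hm m' hm' hne
      simp at hm hm'
      omega
    obtain ⟨T, hT, h1, h2⟩ := aux_sub p hp θ hθ S h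
    have hne : T.Nonempty := by
      rw [Finset.nonempty_iff_ne_empty]
      rintro rfl
      simp at h1; linarith
    have hsum := Finset.sum_sdiff (f := p) hT
    obtain ⟨J, A, hJ, hd, hu, hb, hl⟩ := ih (S \ T) (Finset.sdiff_ssubset hT hne) (by linarith)
    have hAT : ∀ m ∈ Finset.Icc 1 J, Disjoint (A m) T := by
      intro m hm
      have : A m ⊆ S \ T := hu ▸ Finset.subset_biUnion_of_mem A hm
      exact Finset.disjoint_of_subset_left this Finset.sdiff_disjoint
    refine ⟨J + 1, fun m => if m = 1 then T else A (m - 1), by omega, ?_, ?_, ?_, ?_⟩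
    · intro m hm m' hm' hne
      simp only [Finset.mem_Icc] at hm hm' hd hAT
      dsimp only
      split_ifs with c c'
      · omega
      · exact (hAT _ (by omega)).symm
      · exact hAT _ (by omega)
      · exact hd _ (by omega) _ (by omega) (by omega)
    · ext x
      have hx : x ∈ (Finset.Icc 1 J).biUnion A ↔ x ∈ S \ T := by rw [hu]
      simp only [Finset.mem_biUnion, Finset.mem_Icc, Finset.mem_sdiff] at hx ⊢
      constructor
      · rintro ⟨m, hm, hxm⟩
        split_ifs at hxm with c
        · exact hT hxm
        · exact (hx.1 ⟨m - 1, by omega, hxm⟩).1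
      · intro hxS
        by_cases hxT : x ∈ T
        · exact ⟨1, by omega, by simpa using hxT⟩
        · obtain ⟨m, hm, hxm⟩ := hx.2 ⟨hxS, hxT⟩
          refine ⟨m + 1, by omega, ?_⟩
          rw [if_neg (by omega)]
          simpa using hxm
    · intro m hm
      simp only [Finset.mem_Icc] at hm hb
      dsimp only
      split_ifs with c
      · exact ⟨h1, h2⟩
      · exact hb _ (by omega)
    · have : J + 1 ≠ 1 := by omega
      simpa [hJ.ne'] using hl

/-- **Partition construction in the proof of Lemma 2 (Appendix B).** If `p i ∈ [0,1]`,
`θ ≥ 1` and `∑ i, p i ≥ θ`, then `[1:M]` can be partitioned into nonempty pairwise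
disjoint groups `A_1, …, A_J` such that each group mass `∑_{i ∈ A_m} p i` lies in
`[θ, θ+1)` for `m ∈ [1:J-1]` and in `[θ, 2θ+1)` for the last group `A_J`. -/
theorem stmt8 (M : ℕ) (hM : 0 < M) (p : Fin M → ℝ) (hp : ∀ i, p i ∈ Set.Icc (0 : ℝ) 1)
    (θ : ℝ) (hθ : 1 ≤ θ) (hmass : θ ≤ ∑ i, p i) :
    ∃ (J : ℕ) (A : ℕ → Finset (Fin M)), 0 < J ∧
      (∀ m ∈ Finset.Icc 1 J, (A m).Nonempty) ∧
      (∀ m ∈ Finset.Icc 1 J, ∀ m' ∈ Finset.Icc 1 J, m ≠ m' → Disjoint (A m) (A m')) ∧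
      ((Finset.Icc 1 J).biUnion A = Finset.univ) ∧
      (∀ m ∈ Finset.Icc 1 (J - 1), θ ≤ (∑ i ∈ A m, p i) ∧ (∑ i ∈ A m, p i) < θ + 1) ∧
      (θ ≤ (∑ i ∈ A J, p i) ∧ (∑ i ∈ A J, p i) < 2 * θ + 1) := by
  obtain ⟨J, A, hJ, hd, hu, hb, hl⟩ := aux_part p hp θ hθ Finset.univ hmass
  refine ⟨J, A, hJ, ?_, hd, hu, hb, hl⟩
  intro m hm
  have hs : θ ≤ ∑ i ∈ A m, p i := by
    simp only [Finset.mem_Icc] at hm hb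
    by_cases c : m = J
    · rw [c]; exact hl.1
    · exact (hb m (by omega)).1
  rw [Finset.nonempty_iff_ne_empty]
  intro he
  rw [he] at hs
  simp at hs; linarith
end

section
/- For every integer θ ≥ 1, the double series satisfies ∑_{m=5}^{∞} ∑_{j=0}^{θ−1} e^{−(m−1)θ} · ( m·e·(θ+1) )^j / j! < 1. -/
theorem stmt11_aux (k m : ℕ) :
    (∑ j ∈ Finset.range (k+1),
        Real.exp (-((((m : ℝ) + 5) - 1) * ((k+1 : ℕ) : ℝ))) *
          (((m : ℝ) + 5) * Real.exp 1 * (((k+1 : ℕ) : ℝ) + 1)) ^ j / (Nat.factorial j))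
      ≤ 1/4 * (1/2 : ℝ)^m := by
  have hm : (0:ℝ) ≤ m := Nat.cast_nonneg m
  have he : (2:ℝ) ≤ Real.exp 1 := by
    have := Real.add_one_le_exp (1:ℝ)
    linarith
  have hM : (m:ℝ) + 5 ≤ Real.exp (m+2) := by
    have := Real.quadratic_le_exp_of_nonneg (x := (m:ℝ)+2) (by positivity)
    nlinarith
  have hMe : 1 ≤ ((m:ℝ) + 5) * Real.exp 1 := by nlinarith
  have h1 : ∀ j ∈ Finset.range (k+1),
      Real.exp (-((((m : ℝ) + 5) - 1) * ((k+1 : ℕ) : ℝ))) *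
          (((m : ℝ) + 5) * Real.exp 1 * (((k+1 : ℕ) : ℝ) + 1)) ^ j / (Nat.factorial j)
      ≤ Real.exp (-((((m : ℝ) + 5) - 1) * ((k+1 : ℕ) : ℝ))) *
          ((Real.exp (m+2) * Real.exp 1) ^ k) *
            ((((k+1 : ℕ) : ℝ) + 1) ^ j / (Nat.factorial j)) := by
    intro j hj
    have hj' : j ≤ k := by simpa [Nat.lt_succ_iff] using hj
    have h2 : (((m : ℝ) + 5) * Real.exp 1) ^ j ≤ (Real.exp (m+2) * Real.exp 1) ^ k :=
      (pow_le_pow_right₀ hMe hj').trans (by gcongr)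
    rw [mul_pow, ← mul_assoc, mul_div_assoc]
    gcongr
  refine (Finset.sum_le_sum h1).trans ?_
  rw [← Finset.mul_sum]
  have h3 := Real.sum_le_exp_of_nonneg (x := ((k+1 : ℕ) : ℝ) + 1) (by positivity) (k+1)
  refine (mul_le_mul_of_nonneg_left h3 (by positivity)).trans ?_
  rw [← Real.exp_add, ← Real.exp_nat_mul, ← Real.exp_add, ← Real.exp_add]
  have h4 : -((((m : ℝ) + 5) - 1) * ((k+1 : ℕ) : ℝ)) + k * ((m:ℝ) + 2 + 1)
      + (((k+1 : ℕ) : ℝ) + 1) = ((m + 2 : ℕ) : ℝ) * (-1) := by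
    push_cast; ring
  rw [h4, Real.exp_nat_mul]
  have h5 : Real.exp (-1) ≤ 1/2 := by
    rw [Real.exp_neg, inv_eq_one_div]
    gcongr
  calc Real.exp (-1) ^ (m+2) ≤ (1/2 : ℝ)^(m+2) := by gcongr
    _ = 1/4 * (1/2 : ℝ)^m := by ring

/-- **Series bound (eq. (eq:series3m), Appendix B).** For every integer `θ ≥ 1`,
`∑_{m=5}^∞ ∑_{j=0}^{θ-1} e^{-(m-1)θ} (m e (θ+1))^j / j! < 1`.
(The outer sum is reindexed by `m ↦ m + 5`, `m : ℕ`.) -/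
theorem stmt11 (θ : ℕ) (hθ : 1 ≤ θ) :
    (∑' m : ℕ, ∑ j ∈ Finset.range θ,
        Real.exp (-((((m : ℝ) + 5) - 1) * θ)) *
          (((m : ℝ) + 5) * Real.exp 1 * ((θ : ℝ) + 1)) ^ j / (Nat.factorial j))
      < 1 := by
  obtain ⟨k, rfl⟩ : ∃ k, θ = k + 1 := ⟨θ - 1, by omega⟩
  have hs : HasSum (fun m : ℕ => 1/4 * (1/2 : ℝ)^m) (1/4 * 2) :=
    hasSum_geometric_two.mul_left _
  have hle := fun m => stmt11_aux k m
  have hsum := Summable.of_nonneg_of_le (fun m => by positivity) hle hs.summable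
  have := hsum.tsum_le_tsum hle hs.summable
  rw [hs.tsum_eq] at this
  linarith
end
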